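/- For integers $m>0$, $c\ge 0$ and a finite set $\Gamma$ of positive integers, let $\langle m,\Gamma\rangle_c$ denote the additive submonoid of $\mathbb N$ generated by $m$, the elements of $\Gamma$ and all integers $\ge c$. An element $x\neq 0$ of a submonoid $S\subseteq\mathbb N$ is called primitive if it is not the sum of two nonzero elements of $S$. With respect to the parameter $c$ (which need not be the true conductor), let the rank $k$ of $S$ be the number of elements of $S$ smaller than $c$, let $\ell$ be the number of left generators of $S$ (primitive elements smaller than $c$), let $r$ be the number of right generators of $S$ (primitive elements in $[c,c+m)$), let $q=\lceil c/m\rceil$, and let $E=k\ell+qr-c$ be the Eliahou number of $S$. Let $S=\langle m,\Gamma\rangle_c$ and $S'=\langle m,\Gamma\cup\Lambda\rangle_c$, where $0<m<c$ and $\Gamma,\Lambda$ are finite sets of integers $\gamma$ with $m<\gamma<c$. Let $\ell$ and $\ell'$ be the numbers of left generators of $S$ and $S'$, and assume $\ell'>\ell$. (If all elements of $\{m\}\cup\Gamma\cup\Lambda$ are primitive in $S'$ and $\Gamma\cap\Lambda=\emptyset$, then $\ell=1+|\Gamma|$ and $\ell'=1+|\Gamma|+|\Lambda|$, so this just says $\Lambda\neq\emptyset$.)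 Let $c_{\min}\le c\le c_{\max}$ be nonnegative integers and let $k_{\min}$ be the rank of $\langle m,\Gamma\rangle_{c_{\min}}$ with respect to $c_{\min}$, that is, the number of its elements smaller than $c_{\min}$. If $(k_{\min}+1)(\ell+1)\ge c_{\max}$, then the Eliahou number $E'$ of $S'$ satisfies $E'\ge 0$. -/

import Mathlib

namespace Eliahou

/-- The numerical semigroup `⟨m, Γ⟩_c`: the additive submonoid of `ℕ` generated by `m`,
the elements of `Γ` and all integers `≥ c`. -/
def sgp (m : ℕ) (Γ : Finset ℕ) (c : ℕ) : AddSubmonoid ℕ :=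
  AddSubmonoid.closure (insert m (Γ : Set ℕ) ∪ Set.Ici c)

/-- `x` is primitive in `S` (a generator of `S`): it is a nonzero element of `S` that is not
the sum of two nonzero elements of `S`. -/
def IsPrimitive (S : AddSubmonoid ℕ) (x : ℕ) : Prop :=
  x ∈ S ∧ x ≠ 0 ∧ ¬ ∃ u ∈ S, ∃ v ∈ S, u ≠ 0 ∧ v ≠ 0 ∧ u + v = x

/-- The rank `k` with respect to `c`: the number of elements of `S` smaller than `c`. -/
noncomputable def rank (S : AddSubmonoid ℕ) (c : ℕ) : ℕ :=
  {x : ℕ | x ∈ S ∧ x < c}.ncard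

/-- `ℓ`, the number of left generators: the generators of `S` smaller than `c`. -/
noncomputable def nLeftGen (S : AddSubmonoid ℕ) (c : ℕ) : ℕ :=
  {x : ℕ | IsPrimitive S x ∧ x < c}.ncard

/-- `r`, the number of right generators: the primitive elements of `S` in `[c, c + m)`. -/
noncomputable def nRightGen (S : AddSubmonoid ℕ) (m c : ℕ) : ℕ :=
  {x : ℕ | IsPrimitive S x ∧ c ≤ x ∧ x < c + m}.ncard

/-- The Eliahou number `E = kℓ + qr − c` with `q = ⌈c/m⌉`, all parameters being counted with
respect to the given `c` (which need not be the true conductor of `S`). -/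
noncomputable def eliahouNumber (S : AddSubmonoid ℕ) (m c : ℕ) : ℤ :=
  (rank S c : ℤ) * (nLeftGen S c : ℤ) + ⌈(c : ℚ) / (m : ℚ)⌉ * (nRightGen S m c : ℤ) - (c : ℤ)

end Eliahou

namespace Eliahou

theorem sgp_mono_left (m c : ℕ) {Γ Δ : Finset ℕ} (h : Γ ⊆ Δ) : sgp m Γ c ≤ sgp m Δ c :=
  AddSubmonoid.closure_mono <| Set.union_subset_union_left _ <| Set.insert_subset_insert <| by
    exact_mod_cast h

theorem mem_sgp_of_le {m c x : ℕ} (Γ : Finset ℕ) (h : c ≤ x) : x ∈ sgp m Γ c :=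
  AddSubmonoid.subset_closure (Or.inr h)

/-- Below the parameter `c`, the semigroup `⟨m, Γ⟩_c` is generated by `m` and `Γ`. -/
theorem mem_closure_of_mem_sgp_of_lt {m c x : ℕ} {Γ : Finset ℕ} (hx : x ∈ sgp m Γ c)
    (hxc : x < c) : x ∈ AddSubmonoid.closure (insert m (Γ : Set ℕ)) := by
  induction hx using AddSubmonoid.closure_induction with
  | mem y hy =>
    rcases hy with hy | hy
    · exact AddSubmonoid.subset_closure hy
    · exact absurd hxc (not_lt.mpr hy)
  | zero => exact zero_mem _
  | add y z _ _ ihy ihz => exact add_mem (ihy (by lia)) (ihz (by lia))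

theorem finite_mem_and_lt (S : AddSubmonoid ℕ) (c : ℕ) : {x : ℕ | x ∈ S ∧ x < c}.Finite :=
  (Set.finite_lt_nat c).subset fun _ hx => hx.2

/-- The rank of `⟨m, Γ⟩_c` is monotone in `c`. -/
theorem rank_sgp_mono (m : ℕ) (Γ : Finset ℕ) {c d : ℕ} (h : c ≤ d) :
    rank (sgp m Γ c) c ≤ rank (sgp m Γ d) d :=
  Set.ncard_le_ncard
    (fun _ hx => ⟨AddSubmonoid.closure_mono Set.subset_union_left
      (mem_closure_of_mem_sgp_of_lt hx.1 hx.2), hx.2.trans_le h⟩)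
    (finite_mem_and_lt _ _)

/-- Properly enlarging a semigroup that contains all integers `≥ c` increases its rank. -/
theorem rank_lt_rank {S T : AddSubmonoid ℕ} {c : ℕ} (hS : ∀ x, c ≤ x → x ∈ S) (h : S < T) :
    rank S c < rank T c := by
  obtain ⟨hle, x, hxT, hxS⟩ := SetLike.lt_iff_le_and_exists.mp h
  refine Set.ncard_lt_ncard ⟨fun y hy => ⟨hle hy.1, hy.2⟩, fun hsub => hxS ?_⟩
    (finite_mem_and_lt _ _)
  exact (hsub ⟨hxT, not_le.mp fun hcx => hxS (hS x hcx)⟩).1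

/-- The Eliahou number is nonnegative as soon as `c ≤ kℓ`. -/
theorem eliahouNumber_nonneg_of_le {S : AddSubmonoid ℕ} {m c : ℕ}
    (h : c ≤ rank S c * nLeftGen S c) : 0 ≤ eliahouNumber S m c := by
  have hq : 0 ≤ ⌈(c : ℚ) / (m : ℚ)⌉ := Int.ceil_nonneg (by positivity)
  have hqr : 0 ≤ ⌈(c : ℚ) / (m : ℚ)⌉ * (nRightGen S m c : ℤ) := by positivity
  have h' : (c : ℤ) ≤ (rank S c : ℤ) * (nLeftGen S c : ℤ) := by exact_mod_cast h
  unfold eliahouNumber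
  linarith

end Eliahou

/-- Here `S = ⟨m, Γ⟩_c`, and `S' = ⟨m, Γ ∪ Λ⟩_c` is obtained by adding the generators `Λ`;
`ℓ < ℓ'` are their numbers of left generators. -/
theorem prune_criterion (m c cmin cmax : ℕ) (Γ Λ : Finset ℕ)
    (hm : 0 < m) (hmc : m < c)
    (hgen : ∀ γ ∈ Γ ∪ Λ, m < γ ∧ γ < c)
    (hl : Eliahou.nLeftGen (Eliahou.sgp m Γ c) c < Eliahou.nLeftGen (Eliahou.sgp m (Γ ∪ Λ) c) c)
    (hc : cmin ≤ c) (hc' : c ≤ cmax)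
    (hk : cmax ≤ (Eliahou.rank (Eliahou.sgp m Γ cmin) cmin + 1)
      * (Eliahou.nLeftGen (Eliahou.sgp m Γ c) c + 1)) :
    0 ≤ Eliahou.eliahouNumber (Eliahou.sgp m (Γ ∪ Λ) c) m c := by
  have hlt : Eliahou.sgp m Γ c < Eliahou.sgp m (Γ ∪ Λ) c :=
    lt_of_le_of_ne (Eliahou.sgp_mono_left m c Finset.subset_union_left)
      fun h => hl.ne (by rw [← h])
  have hrank := (Eliahou.rank_sgp_mono m Γ hc).trans_lt
    (Eliahou.rank_lt_rank (fun _ => Eliahou.mem_sgp_of_le Γ) hlt)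
  exact Eliahou.eliahouNumber_nonneg_of_le (hc'.trans (hk.trans (Nat.mul_le_mul hrank hl)))
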